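/- arXiv:2512.11576 — 2 statements merged into one kernel-verified Lean document; each statement's English description precedes it below -/
import Mathlib

section
/- Let N ≥ 1 be an integer, let B¹, …, B^M ⊆ ℝ^N be measurable sets of finite positive Lebesgue measure such that every point of ℝ^N lies in at most K of the sets B^i, let ω_i : ℝ^N → ℝ be measurable with 0 ≤ ω_i ≤ 1 and support contained in B^i, and let Λ_i ≥ 0 be constants. Let u : ℝ^N → ℝ be continuously differentiable and let h : ℝ^N → ℝ be measurable with h² integrable on ⋃_i B^i. Set E := max_{1≤i≤M} |B^i|^{−1} ∫_{B^i} (|Du|² + |u|² Λ_i²) dx, assumed finite. Then Σ_{i=1}^M (h_{B^i})² · ∫_{B^i} (|Du(x)|² ω_i(x)² + |u(x)|² Λ_i²) dx ≤ K · E · ∫_{⋃_i B^i} h(x)² dx. -/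
open MeasureTheory Metric ENNReal
open scoped ENNReal Topology

noncomputable section

abbrev Euc (N : ℕ) := EuclideanSpace ℝ (Fin N)

/-- Jensen's inequality for the square of an average, with values in `ℝ≥0∞`. -/
theorem ofReal_setAverage_sq_le {α : Type*} [MeasurableSpace α] {μ : Measure α} {s : Set α}
    (hs0 : μ s ≠ 0) (hs : μ s ≠ ⊤) {f : α → ℝ} (hf : AEMeasurable f (μ.restrict s)) :
    ENNReal.ofReal ((⨍ x in s, f x ∂μ) ^ 2) ≤
      (μ s)⁻¹ * ∫⁻ x in s, ENNReal.ofReal ((f x) ^ 2) ∂μ := by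
  have enorm_sq : ∀ a : ℝ, ENNReal.ofReal (a ^ 2) = ‖a‖ₑ ^ 2 := fun a => by
    rw [← sq_abs, ENNReal.ofReal_pow (abs_nonneg a), Real.enorm_eq_ofReal_abs]
  simp only [enorm_sq]
  have holder : (∫⁻ x in s, ‖f x‖ₑ ∂μ) ^ 2 ≤ μ s * ∫⁻ x in s, ‖f x‖ₑ ^ 2 ∂μ := by
    have := ENNReal.lintegral_mul_le_Lp_mul_Lq (μ.restrict s) Real.HolderConjugate.two_two
      (aemeasurable_const (b := (1 : ℝ≥0∞))) hf.enorm
    simp only [Pi.mul_apply, one_mul, ENNReal.one_rpow, lintegral_const,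
      Measure.restrict_apply_univ] at this
    refine (pow_le_pow_left₀ zero_le this 2).trans_eq ?_
    rw [mul_pow, ← ENNReal.rpow_natCast, ← ENNReal.rpow_natCast, ← ENNReal.rpow_mul,
      ← ENNReal.rpow_mul]
    norm_num
  have average : ‖⨍ x in s, f x ∂μ‖ₑ ≤ (μ s)⁻¹ * ∫⁻ x in s, ‖f x‖ₑ ∂μ := by
    rw [setAverage_eq, enorm_smul]
    gcongr
    · rw [Real.enorm_eq_ofReal (by positivity), measureReal_def, ← ENNReal.toReal_inv,
        ENNReal.ofReal_toReal (ENNReal.inv_ne_top.mpr hs0)]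
    · exact enorm_integral_le_lintegral_enorm _
  calc ‖⨍ x in s, f x ∂μ‖ₑ ^ 2 ≤ ((μ s)⁻¹ * ∫⁻ x in s, ‖f x‖ₑ ∂μ) ^ 2 := by gcongr
    _ = (μ s)⁻¹ * ((μ s)⁻¹ * (∫⁻ x in s, ‖f x‖ₑ ∂μ) ^ 2) := by ring
    _ ≤ (μ s)⁻¹ * ((μ s)⁻¹ * (μ s * ∫⁻ x in s, ‖f x‖ₑ ^ 2 ∂μ)) := by gcongr
    _ = (μ s)⁻¹ * ∫⁻ x in s, ‖f x‖ₑ ^ 2 ∂μ := by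
      rw [← mul_assoc (μ s)⁻¹ (μ s), ENNReal.inv_mul_cancel hs0 hs, one_mul]

/-- The integrals over a finite family of sets of multiplicity at most `K` sum up to at most
`K` times the integral over the union. -/
theorem sum_setLIntegral_le_mul_setLIntegral_iUnion {α ι : Type*} [MeasurableSpace α] [Fintype ι]
    {μ : Measure α} {s : ι → Set α} (hs : ∀ i, MeasurableSet (s i)) {K : ℕ}
    (hK : ∀ x, {i | x ∈ s i}.ncard ≤ K) {f : α → ℝ≥0∞} (hf : Measurable f) :
    ∑ i, ∫⁻ x in s i, f x ∂μ ≤ K * ∫⁻ x in ⋃ i, s i, f x ∂μ := by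
  classical
  rw [← lintegral_const_mul _ hf, ← lintegral_indicator (MeasurableSet.iUnion hs)]
  simp_rw [← lintegral_indicator (hs _)]
  rw [← lintegral_finsetSum _ fun i _ => hf.indicator (hs i)]
  refine lintegral_mono fun x => ?_
  by_cases hx : x ∈ ⋃ i, s i
  · have hcard := hK x
    rw [Set.ncard_eq_toFinset_card', Set.toFinset_ofPred] at hcard
    rw [Set.indicator_of_mem hx]
    simp only [Set.indicator_apply, ← Finset.sum_filter, Finset.sum_const, nsmul_eq_mul]
    gcongr
  · rw [Set.indicator_of_notMem hx]
    simp only [Set.mem_iUnion, not_exists] at hx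
    simp [hx]

/-- estimate of the sum over a covering with finite intersection property. -/
theorem stmt_4 (N : ℕ) (hN : 1 ≤ N) (M K : ℕ)
    (B : Fin M → Set (Euc N))
    (hBmeas : ∀ i, MeasurableSet (B i))
    (hBpos : ∀ i, 0 < volume (B i))
    (hBfin : ∀ i, volume (B i) < ⊤)
    (hK : ∀ x : Euc N, {i : Fin M | x ∈ B i}.ncard ≤ K)
    (ωi : Fin M → Euc N → ℝ)
    (hωmeas : ∀ i, Measurable (ωi i))
    (hωi01 : ∀ i x, 0 ≤ ωi i x ∧ ωi i x ≤ 1)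
    (hωsupp : ∀ i, Function.support (ωi i) ⊆ B i)
    (Λ : Fin M → ℝ) (hΛ : ∀ i, 0 ≤ Λ i)
    (u : Euc N → ℝ) (hu : ContDiff ℝ 1 u)
    (h : Euc N → ℝ) (hhmeas : Measurable h)
    (hh2 : IntegrableOn (fun x => (h x)^2) (⋃ i, B i) volume)
    (hE : (⨆ i : Fin M, (volume (B i))⁻¹ *
        ∫⁻ x in B i, ENNReal.ofReal (‖gradient u x‖^2 + (u x)^2 * (Λ i)^2)) ≠ ⊤) :
    (∑ i : Fin M, ENNReal.ofReal ((⨍ x in B i, h x ∂volume)^2) *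
        ∫⁻ x in B i, ENNReal.ofReal (‖gradient u x‖^2 * (ωi i x)^2 + (u x)^2 * (Λ i)^2)) ≤
      (K : ℝ≥0∞) *
        (⨆ i : Fin M, (volume (B i))⁻¹ *
          ∫⁻ x in B i, ENNReal.ofReal (‖gradient u x‖^2 + (u x)^2 * (Λ i)^2)) *
        ∫⁻ x in ⋃ i, B i, ENNReal.ofReal ((h x)^2) := by
  set E := ⨆ i : Fin M, (volume (B i))⁻¹ *
    ∫⁻ x in B i, ENNReal.ofReal (‖gradient u x‖^2 + (u x)^2 * (Λ i)^2)
  calc _ ≤ ∑ i, E * ∫⁻ x in B i, ENNReal.ofReal ((h x)^2) := Finset.sum_le_sum fun i _ => ?_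
    _ = E * ∑ i, ∫⁻ x in B i, ENNReal.ofReal ((h x)^2) := (Finset.mul_sum ..).symm
    _ ≤ E * (K * ∫⁻ x in ⋃ i, B i, ENNReal.ofReal ((h x)^2)) := by
      gcongr
      exact sum_setLIntegral_le_mul_setLIntegral_iUnion hBmeas hK (by fun_prop)
    _ = _ := by ring
  have weight : ∫⁻ x in B i, ENNReal.ofReal (‖gradient u x‖^2 * (ωi i x)^2 + (u x)^2 * (Λ i)^2) ≤
      ∫⁻ x in B i, ENNReal.ofReal (‖gradient u x‖^2 + (u x)^2 * (Λ i)^2) := by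
    refine lintegral_mono fun x => ENNReal.ofReal_le_ofReal ?_
    gcongr
    exact mul_le_of_le_one_right (by positivity) (pow_le_one₀ (hωi01 i x).1 (hωi01 i x).2)
  calc _ ≤ ((volume (B i))⁻¹ * ∫⁻ x in B i, ENNReal.ofReal ((h x)^2)) *
        ∫⁻ x in B i, ENNReal.ofReal (‖gradient u x‖^2 + (u x)^2 * (Λ i)^2) :=
      mul_le_mul' (ofReal_setAverage_sq_le (hBpos i).ne' (hBfin i).ne hhmeas.aemeasurable) weight
    _ = ((volume (B i))⁻¹ *
          ∫⁻ x in B i, ENNReal.ofReal (‖gradient u x‖^2 + (u x)^2 * (Λ i)^2)) *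
        ∫⁻ x in B i, ENNReal.ofReal ((h x)^2) := by ring
    _ ≤ _ := by
      gcongr
      exact le_iSup (fun i => (volume (B i))⁻¹ *
        ∫⁻ x in B i, ENNReal.ofReal (‖gradient u x‖^2 + (u x)^2 * (Λ i)^2)) i
end
end

section
/- Let N > 2 be an integer, p ≥ 1 a real number, and H : ℝ^N → ℝ continuously differentiable. Set h := |H|^{p−1}H and s := 2N/(N−2). Then there exists a constant C depending only on N and p such that for every y ∈ ℝ^N and every ε > 0, (1/ε) · ( ⨍_{B_ε(y)} |h(x) − h_{B_ε(y)}|^s dx )^{1/s} ≤ C · ( M(|H|^{2(p−1)}|DH|²)(y) )^{1/2}, where h_{B_ε(y)} is the average of h over the ball B_ε(y). -/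
open MeasureTheory Metric ENNReal
open scoped ENNReal Topology

noncomputable section

/-- Centered Hardy–Littlewood maximal function. -/
def maxFn {N : ℕ} (F : Euc N → ℝ) (y : Euc N) : ℝ≥0∞ :=
  ⨆ (ε : ℝ) (_ : 0 < ε),
    (∫⁻ x in ball y ε, ENNReal.ofReal |F x| ∂volume) / volume (ball y ε)

theorem sq_lintegral_le_lintegral_sq {α : Type*} [MeasurableSpace α] (ν : Measure α)
    [IsProbabilityMeasure ν] {f : α → ℝ≥0∞} (hf : AEMeasurable f ν) :
    (∫⁻ x, f x ∂ν) ^ 2 ≤ ∫⁻ x, f x ^ 2 ∂ν := by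
  have h := ENNReal.lintegral_mul_le_Lp_mul_Lq ν Real.HolderConjugate.two_two hf
    (aemeasurable_const (b := (1 : ℝ≥0∞)))
  simp only [Pi.mul_apply, mul_one, ENNReal.rpow_two, one_pow, lintegral_const, measure_univ,
    ENNReal.one_rpow] at h
  calc (∫⁻ x, f x ∂ν) ^ 2 ≤ ((∫⁻ x, f x ^ 2 ∂ν) ^ (1 / 2 : ℝ)) ^ 2 := by gcongr
    _ = ∫⁻ x, f x ^ 2 ∂ν := by
      rw [← ENNReal.rpow_two, ← ENNReal.rpow_mul]; norm_num

theorem add_sq_le_two_mul_add_sq {a b : ℝ≥0∞} : (a + b) ^ 2 ≤ 2 * (a ^ 2 + b ^ 2) := by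
  have h := ENNReal.rpow_add_le_mul_rpow_add_rpow a b (p := 2) (by norm_num)
  norm_num at h
  exact h

section

variable {E : Type*} [NormedAddCommGroup E] [NormedSpace ℝ E]

theorem preimage_add_smul_ball (y : E) {ε : ℝ} (hε : 0 < ε) (r : ℝ) :
    (fun x => y + ε • x) ⁻¹' ball y (ε * r) = ball 0 r := by
  ext x
  simp [norm_smul, abs_of_pos hε, hε]

theorem enorm_sub_sq_le_lintegral_fderiv {g : E → ℝ} (hg : ContDiff ℝ 1 g) (x z : E) :
    ‖g x - g z‖ₑ ^ 2 ≤
      ‖x - z‖ₑ ^ 2 * ∫⁻ t in Set.Ioc (0 : ℝ) 1, ‖fderiv ℝ g (z + t • (x - z))‖ₑ ^ 2 := by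
  have hcont : Continuous (fun t : ℝ => fderiv ℝ g (z + t • (x - z))) :=
    (hg.continuous_fderiv one_ne_zero).comp (by fun_prop)
  have hder : ∀ t ∈ Set.uIcc (0 : ℝ) 1, HasDerivAt (fun t : ℝ => g (z + t • (x - z)))
      (fderiv ℝ g (z + t • (x - z)) (x - z)) t := by
    intro t _
    have h1 : HasDerivAt (fun t : ℝ => z + t • (x - z)) (x - z) t := by
      simpa using ((hasDerivAt_id t).smul_const (x - z)).const_add z
    exact ((hg.differentiable one_ne_zero _).hasFDerivAt).comp_hasDerivAt t h1
  have hint := intervalIntegral.integral_eq_sub_of_hasDerivAt hder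
    ((hcont.clm_apply continuous_const).intervalIntegrable _ _)
  simp only [one_smul, add_sub_cancel, zero_smul, add_zero] at hint
  have : IsProbabilityMeasure (volume.restrict (Set.Ioc (0 : ℝ) 1)) := ⟨by simp⟩
  rw [← hint, intervalIntegral.integral_of_le zero_le_one]
  calc _ ≤ (∫⁻ t in Set.Ioc (0 : ℝ) 1, ‖fderiv ℝ g (z + t • (x - z)) (x - z)‖ₑ) ^ 2 := by
        gcongr
        exact enorm_integral_le_lintegral_enorm _
    _ ≤ ∫⁻ t in Set.Ioc (0 : ℝ) 1, ‖fderiv ℝ g (z + t • (x - z)) (x - z)‖ₑ ^ 2 :=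
        sq_lintegral_le_lintegral_sq _
          (hcont.clm_apply continuous_const).measurable.enorm.aemeasurable
    _ ≤ ∫⁻ t in Set.Ioc (0 : ℝ) 1, ‖x - z‖ₑ ^ 2 * ‖fderiv ℝ g (z + t • (x - z))‖ₑ ^ 2 := by
        refine lintegral_mono fun t => ?_
        rw [← mul_pow, mul_comm]
        gcongr
        exact ContinuousLinearMap.le_opENorm _ _
    _ = _ := lintegral_const_mul _ (hcont.measurable.enorm.pow_const 2)

variable [MeasurableSpace E]

theorem measurableEmbedding_add_smul [BorelSpace E] (b : E) {a : ℝ} (ha : a ≠ 0) :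
    MeasurableEmbedding (fun x : E => b + a • x) :=
  (measurableEmbedding_addLeft b).comp (Homeomorph.smulOfNeZero a ha).measurableEmbedding

variable [FiniteDimensional ℝ E] (μ : Measure E) [μ.IsAddHaarMeasure]

theorem isProbabilityMeasure_cond_ball (y : E) {r : ℝ} (hr : 0 < r) :
    IsProbabilityMeasure (ProbabilityTheory.cond μ (ball y r)) :=
  ProbabilityTheory.cond_isProbabilityMeasure_of_finite (measure_ball_pos μ y hr).ne'
    measure_ball_lt_top.ne

variable [BorelSpace E]

theorem map_add_smul_addHaar (b : E) {a : ℝ} (ha : a ≠ 0) :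
    μ.map (fun x => b + a • x) = ENNReal.ofReal |(a ^ Module.finrank ℝ E)⁻¹| • μ := by
  have : (fun x : E => b + a • x) = (fun x => b + x) ∘ (fun x => a • x) := rfl
  rw [this, ← Measure.map_map (by fun_prop) (by fun_prop), Measure.map_addHaar_smul μ ha,
    Measure.map_smul, map_add_left_eq_self]

theorem map_cond_ball (y : E) {ε : ℝ} (hε : 0 < ε) (r : ℝ) :
    (ProbabilityTheory.cond μ (ball 0 r)).map (fun x => y + ε • x) =
      ProbabilityTheory.cond μ (ball y (ε * r)) := by
  set c := ENNReal.ofReal |(ε ^ Module.finrank ℝ E)⁻¹| with hc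
  have hc0 : c ≠ 0 := by
    simp only [hc, ne_eq, ENNReal.ofReal_eq_zero, not_le]
    positivity
  have hct : c ≠ ⊤ := ENNReal.ofReal_ne_top
  have hm := measurableEmbedding_add_smul y hε.ne'
  have h1 : (μ.restrict (ball 0 r)).map (fun x => y + ε • x) =
      c • μ.restrict (ball y (ε * r)) := by
    rw [← Measure.restrict_smul, hc, ← map_add_smul_addHaar μ y hε.ne', hm.restrict_map,
      preimage_add_smul_ball y hε r]
  have h2 : μ (ball 0 r) = c * μ (ball y (ε * r)) := by
    have := congrArg (fun ν => ν Set.univ) h1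
    simpa [hm.map_apply] using this
  rw [ProbabilityTheory.cond, ProbabilityTheory.cond, Measure.map_smul, h1, h2, smul_smul,
    ENNReal.mul_inv (Or.inl hc0) (Or.inl hct), mul_assoc, mul_comm, mul_assoc,
    ENNReal.mul_inv_cancel hc0 hct, mul_one]

/-- Contracting a set into itself by a factor at least `1 / 2` distorts integrals by a bounded
amount. -/
theorem setLIntegral_comp_add_smul_le {s : Set E} (hs : MeasurableSet s) (b : E) {a : ℝ}
    (ha : 1 / 2 ≤ a) (hmaps : ∀ x ∈ s, b + a • x ∈ s) (f : E → ℝ≥0∞) :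
    ∫⁻ x in s, f (b + a • x) ∂μ ≤ 2 ^ Module.finrank ℝ E * ∫⁻ x in s, f x ∂μ := by
  have ha0 : 0 < a := by linarith
  calc ∫⁻ x in s, f (b + a • x) ∂μ
      ≤ ∫⁻ x, s.indicator f (b + a • x) ∂μ := by
        rw [← lintegral_indicator hs]
        refine lintegral_mono fun x => ?_
        by_cases hx : x ∈ s
        · simp [hx, hmaps x hx]
        · simp [hx]
    _ = ENNReal.ofReal |(a ^ Module.finrank ℝ E)⁻¹| * ∫⁻ x in s, f x ∂μ := by
        rw [← (measurableEmbedding_add_smul b ha0.ne').lintegral_map (s.indicator f),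
          map_add_smul_addHaar μ b ha0.ne', lintegral_smul_measure, lintegral_indicator hs,
          smul_eq_mul]
    _ ≤ _ := by
        gcongr
        rw [abs_of_pos (by positivity), ← inv_pow, ← ENNReal.ofReal_ofNat 2,
          ← ENNReal.ofReal_pow (by norm_num)]
        gcongr
        rw [inv_le_comm₀ ha0 (by norm_num)]
        linarith

theorem lintegral_lintegral_segment_le {s : Set E} (hs : MeasurableSet s) (hc : Convex ℝ s)
    {f : E → ℝ≥0∞} (hf : Measurable f) {t : ℝ} (ht : t ∈ Set.Icc (0 : ℝ) 1) :
    ∫⁻ x in s, ∫⁻ z in s, f (z + t • (x - z)) ∂μ ∂μ ≤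
      2 ^ Module.finrank ℝ E * μ s * ∫⁻ x in s, f x ∂μ := by
  obtain ⟨h0, h1⟩ := ht
  have key : ∀ a : ℝ, 1 / 2 ≤ a → a ≤ 1 → ∫⁻ x in s, ∫⁻ z in s, f ((1 - a) • x + a • z) ∂μ ∂μ ≤
      2 ^ Module.finrank ℝ E * μ s * ∫⁻ x in s, f x ∂μ := by
    intro a ha ha1
    calc ∫⁻ x in s, ∫⁻ z in s, f ((1 - a) • x + a • z) ∂μ ∂μ
        ≤ ∫⁻ x in s, 2 ^ Module.finrank ℝ E * ∫⁻ z in s, f z ∂μ ∂μ := by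
          refine setLIntegral_mono' hs fun x hx => ?_
          exact setLIntegral_comp_add_smul_le μ hs _ ha
            (fun z hz => hc hx hz (by linarith) (by linarith) (by ring)) f
      _ = _ := by
          rw [lintegral_const, Measure.restrict_apply_univ]; ring
  by_cases h : t ≤ 1 / 2
  · convert key (1 - t) (by linarith) (by linarith) using 6
    module
  · rw [lintegral_lintegral_swap (by fun_prop)]
    convert key t (by linarith) h1 using 6
    module

theorem lintegral_lintegral_lintegral_segment_le {s : Set E} (hs : MeasurableSet s)
    (hc : Convex ℝ s) {f : E → ℝ≥0∞} (hf : Measurable f) :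
    ∫⁻ x in s, ∫⁻ z in s, (∫⁻ t in Set.Ioc (0 : ℝ) 1, f (z + t • (x - z))) ∂μ ∂μ ≤
      2 ^ Module.finrank ℝ E * μ s * ∫⁻ x in s, f x ∂μ := by
  have hm : Measurable (fun q : E × ℝ => ∫⁻ z in s, f (z + q.2 • (q.1 - z)) ∂μ) :=
    Measurable.lintegral_prod_right' (ν := μ.restrict s)
      (f := fun q : (E × ℝ) × E => f (q.2 + q.1.2 • (q.1.1 - q.2))) (hf.comp (by fun_prop))
  calc ∫⁻ x in s, ∫⁻ z in s, (∫⁻ t in Set.Ioc (0 : ℝ) 1, f (z + t • (x - z))) ∂μ ∂μ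
      = ∫⁻ x in s, (∫⁻ t in Set.Ioc (0 : ℝ) 1, ∫⁻ z in s, f (z + t • (x - z)) ∂μ) ∂μ := by
        refine lintegral_congr fun x => lintegral_lintegral_swap ?_
        exact (hf.comp (by fun_prop)).aemeasurable
    _ = ∫⁻ t in Set.Ioc (0 : ℝ) 1, ∫⁻ x in s, ∫⁻ z in s, f (z + t • (x - z)) ∂μ ∂μ :=
        lintegral_lintegral_swap hm.aemeasurable
    _ ≤ ∫⁻ t in Set.Ioc (0 : ℝ) 1, 2 ^ Module.finrank ℝ E * μ s * ∫⁻ x in s, f x ∂μ :=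
        setLIntegral_mono' measurableSet_Ioc fun t ht =>
          lintegral_lintegral_segment_le μ hs hc hf ⟨ht.1.le, ht.2⟩
    _ = _ := by simp

/-- A Poincaré inequality on bounded convex sets, in double integral form. -/
theorem lintegral_lintegral_enorm_sub_sq_le {s : Set E} (hs : MeasurableSet s)
    (hc : Convex ℝ s) {d : ℝ≥0∞} (hd_top : d ≠ ⊤) (hd : ∀ x ∈ s, ∀ z ∈ s, ‖x - z‖ₑ ≤ d)
    {g : E → ℝ} (hg : ContDiff ℝ 1 g) :
    ∫⁻ x in s, ∫⁻ z in s, ‖g x - g z‖ₑ ^ 2 ∂μ ∂μ ≤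
      d ^ 2 * (2 ^ Module.finrank ℝ E * μ s) * ∫⁻ x in s, ‖fderiv ℝ g x‖ₑ ^ 2 ∂μ := by
  have hd2 : d ^ 2 ≠ ⊤ := ENNReal.pow_ne_top hd_top
  calc ∫⁻ x in s, ∫⁻ z in s, ‖g x - g z‖ₑ ^ 2 ∂μ ∂μ
      ≤ ∫⁻ x in s, ∫⁻ z in s, d ^ 2 * (∫⁻ t in Set.Ioc (0 : ℝ) 1,
          ‖fderiv ℝ g (z + t • (x - z))‖ₑ ^ 2) ∂μ ∂μ := by
        refine setLIntegral_mono' hs fun x hx => setLIntegral_mono' hs fun z hz => ?_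
        refine (enorm_sub_sq_le_lintegral_fderiv hg x z).trans ?_
        gcongr
        exact hd x hx z hz
    _ = d ^ 2 * ∫⁻ x in s, ∫⁻ z in s, (∫⁻ t in Set.Ioc (0 : ℝ) 1,
          ‖fderiv ℝ g (z + t • (x - z))‖ₑ ^ 2) ∂μ ∂μ := by
        simp_rw [lintegral_const_mul' _ _ hd2]
    _ ≤ d ^ 2 * (2 ^ Module.finrank ℝ E * μ s * ∫⁻ x in s, ‖fderiv ℝ g x‖ₑ ^ 2 ∂μ) :=
        mul_le_mul' le_rfl (lintegral_lintegral_lintegral_segment_le μ hs hc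
          ((hg.continuous_fderiv one_ne_zero).measurable.enorm.pow_const 2))
    _ = _ := (mul_assoc _ _ _).symm

theorem integrable_cond_ball {g : E → ℝ} (hg : Continuous g) (y : E) (r : ℝ) :
    Integrable g (ProbabilityTheory.cond μ (ball y r)) := by
  by_cases h : μ (ball y r) = 0
  · rw [ProbabilityTheory.cond_eq_zero_of_meas_eq_zero h]
    exact integrable_zero_measure
  · exact (((hg.continuousOn.integrableOn_compact (isCompact_closedBall y r)).mono_set
      ball_subset_closedBall).integrable).smul_measure (ENNReal.inv_ne_top.mpr h)

theorem enorm_sub_average_sq_le (s : Set E) {g : E → ℝ} (hg : Continuous g) {y : E} {r : ℝ}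
    (hr : 0 < r) (hs : ball y r ⊆ s) (x : E) :
    ‖g x - ∫ z, g z ∂(ProbabilityTheory.cond μ (ball y r))‖ₑ ^ 2 ≤
      (μ (ball y r))⁻¹ * ∫⁻ z in s, ‖g x - g z‖ₑ ^ 2 ∂μ := by
  have := isProbabilityMeasure_cond_ball μ y hr
  set ν := ProbabilityTheory.cond μ (ball y r) with hν
  have h1 : g x - ∫ z, g z ∂ν = ∫ z, (g x - g z) ∂ν := by
    rw [integral_sub (integrable_const _) (integrable_cond_ball μ hg y r)]
    simp [hν]
  rw [h1]
  calc _ ≤ (∫⁻ z, ‖g x - g z‖ₑ ∂ν) ^ 2 := by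
        gcongr
        exact enorm_integral_le_lintegral_enorm _
    _ ≤ ∫⁻ z, ‖g x - g z‖ₑ ^ 2 ∂ν := sq_lintegral_le_lintegral_sq _ (by fun_prop)
    _ = (μ (ball y r))⁻¹ * ∫⁻ z in ball y r, ‖g x - g z‖ₑ ^ 2 ∂μ := by
        rw [hν, ProbabilityTheory.cond, lintegral_smul_measure, smul_eq_mul]
    _ ≤ _ := by
        gcongr

/-- The Poincaré inequality on the ball of radius `2`, for the mean over the unit ball. -/
theorem lintegral_enorm_sub_average_sq_le {g : E → ℝ} (hg : ContDiff ℝ 1 g) :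
    ∫⁻ x in ball 0 2, ‖g x - ∫ z, g z ∂(ProbabilityTheory.cond μ (ball 0 1))‖ₑ ^ 2 ∂μ ≤
      (μ (ball 0 1))⁻¹ * (4 ^ 2 * (2 ^ Module.finrank ℝ E * μ (ball 0 2))) *
        ∫⁻ x in ball 0 2, ‖fderiv ℝ g x‖ₑ ^ 2 ∂μ := by
  have hcont := hg.continuous
  calc _ ≤ ∫⁻ x in ball 0 2, (μ (ball 0 1))⁻¹ * ∫⁻ z in ball 0 2, ‖g x - g z‖ₑ ^ 2 ∂μ ∂μ :=
        lintegral_mono fun x => enorm_sub_average_sq_le μ (ball 0 2) hcont one_pos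
          (ball_subset_ball one_le_two) x
    _ = (μ (ball 0 1))⁻¹ * ∫⁻ x in ball 0 2, ∫⁻ z in ball 0 2, ‖g x - g z‖ₑ ^ 2 ∂μ ∂μ :=
        lintegral_const_mul' _ _ (ENNReal.inv_ne_top.mpr (measure_ball_pos μ 0 one_pos).ne')
    _ ≤ (μ (ball 0 1))⁻¹ * (4 ^ 2 * (2 ^ Module.finrank ℝ E * μ (ball 0 2)) *
          ∫⁻ x in ball 0 2, ‖fderiv ℝ g x‖ₑ ^ 2 ∂μ) := by
        gcongr
        refine lintegral_lintegral_enorm_sub_sq_le μ measurableSet_ball (convex_ball 0 2)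
          (d := 4) (by simp)
          (fun x hx z hz => ?_) hg
        rw [mem_ball_zero_iff] at hx hz
        rw [← ofReal_norm, ← ENNReal.ofReal_ofNat 4]
        refine ENNReal.ofReal_le_ofReal ((norm_sub_le x z).trans ?_)
        linarith
    _ = _ := by ring

theorem exists_eLpNorm_sub_average_le {p : NNReal} (hn : 0 < Module.finrank ℝ E)
    (hp : (p : ℝ)⁻¹ = 2⁻¹ - (Module.finrank ℝ E : ℝ)⁻¹) :
    ∃ C : ℝ≥0∞, C ≠ ⊤ ∧ ∀ g : E → ℝ, ContDiff ℝ 1 g →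
      eLpNorm (fun x => g x - ∫ z, g z ∂(ProbabilityTheory.cond μ (ball 0 1))) p
        (μ.restrict (ball 0 1)) ≤
      C * (∫⁻ x in ball 0 2, ‖fderiv ℝ g x‖ₑ ^ 2 ∂μ) ^ (1 / 2 : ℝ) := by
  let η : ContDiffBump (0 : E) := ⟨1, 3 / 2, one_pos, by norm_num⟩
  have hη : ContDiff ℝ 1 η := η.contDiff
  obtain ⟨K, hK⟩ := (hη.continuous_fderiv one_ne_zero).bounded_above_of_compact_support
    (η.hasCompactSupport.fderiv ℝ)
  set k : ℝ≥0∞ := ENNReal.ofReal K with hk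
  have hKe : ∀ x, ‖fderiv ℝ η x‖ₑ ≤ k := fun x => by
    rw [← ofReal_norm]
    exact ENNReal.ofReal_le_ofReal (hK x)
  set A : ℝ≥0∞ := (μ (ball 0 1))⁻¹ * (4 ^ 2 * (2 ^ Module.finrank ℝ E * μ (ball (0 : E) 2)))
  have hA_top : A ≠ ⊤ :=
    ENNReal.mul_ne_top (ENNReal.inv_ne_top.mpr (measure_ball_pos μ 0 one_pos).ne')
      (ENNReal.mul_ne_top (by simp) (ENNReal.mul_ne_top (by simp) measure_ball_lt_top.ne))
  refine ⟨SNormLESNormFDerivOfEqConst ℝ μ 2 * (2 * (1 + k ^ 2 * A)) ^ (1 / 2 : ℝ), ?_, ?_⟩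
  · refine ENNReal.mul_ne_top (by simp) (ENNReal.rpow_ne_top_of_nonneg (by norm_num) ?_)
    refine ENNReal.mul_ne_top (by simp) (ENNReal.add_ne_top.mpr ⟨by simp, ?_⟩)
    exact ENNReal.mul_ne_top (by simp [hk]) hA_top
  intro g hg
  set c := ∫ z, g z ∂(ProbabilityTheory.cond μ (ball 0 1))
  set D := ∫⁻ x in ball 0 2, ‖fderiv ℝ g x‖ₑ ^ 2 ∂μ
  set u : E → ℝ := fun x => η x * (g x - c) with hu_def
  have hgc : ContDiff ℝ 1 (fun x => g x - c) := hg.sub contDiff_const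
  have hu : ContDiff ℝ 1 u := hη.mul hgc
  have h2u : HasCompactSupport u := η.hasCompactSupport.mul_right
  have hfd : ∀ x, fderiv ℝ u x = η x • fderiv ℝ g x + (g x - c) • fderiv ℝ η x := fun x => by
    rw [hu_def, fderiv_fun_mul (hη.differentiable one_ne_zero x)
      (hgc.differentiable one_ne_zero x), fderiv_sub_const]
  have hsq : ∀ x, ‖fderiv ℝ u x‖ₑ ^ 2 ≤ (ball 0 2).indicator
      (fun x => 2 * (‖fderiv ℝ g x‖ₑ ^ 2 + k ^ 2 * ‖g x - c‖ₑ ^ 2)) x := fun x => by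
    by_cases hx : x ∈ ball 0 2
    · rw [Set.indicator_of_mem hx, hfd]
      calc _ ≤ (‖fderiv ℝ g x‖ₑ + k * ‖g x - c‖ₑ) ^ 2 := by
            gcongr
            refine (enorm_add_le (η x • fderiv ℝ g x) ((g x - c) • fderiv ℝ η x)).trans ?_
            rw [enorm_smul, enorm_smul, mul_comm k]
            gcongr
            · refine mul_le_of_le_one_left' ?_
              rw [← ofReal_norm, Real.norm_of_nonneg η.nonneg]
              exact ENNReal.ofReal_le_one.mpr η.le_one
            · exact hKe x
        _ ≤ _ := by
            rw [← mul_pow]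
            exact add_sq_le_two_mul_add_sq
    · have hx' : x ∉ tsupport u := fun h => hx <| by
        have h1 : x ∈ tsupport η := tsupport_mul_subset_left h
        rw [η.tsupport_eq] at h1
        exact closedBall_subset_ball (by norm_num) h1
      rw [fderiv_of_notMem_tsupport (𝕜 := ℝ) hx', ← ofReal_norm, norm_zero]
      simp
  have hint : ∫⁻ x, ‖fderiv ℝ u x‖ₑ ^ 2 ∂μ ≤ 2 * (1 + k ^ 2 * A) * D := by
    calc _ ≤ ∫⁻ x in ball 0 2, 2 * (‖fderiv ℝ g x‖ₑ ^ 2 + k ^ 2 * ‖g x - c‖ₑ ^ 2) ∂μ := by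
          rw [← lintegral_indicator measurableSet_ball]
          exact lintegral_mono hsq
      _ = 2 * (D + k ^ 2 * ∫⁻ x in ball 0 2, ‖g x - c‖ₑ ^ 2 ∂μ) := by
          have hm : Measurable (fun x => ‖g x - c‖ₑ ^ 2) := by
            have := hgc.continuous.measurable
            fun_prop
          rw [lintegral_const_mul' _ _ (by simp), lintegral_add_right _ (hm.const_mul _),
            lintegral_const_mul _ hm]
      _ ≤ 2 * (D + k ^ 2 * (A * D)) := by
          gcongr
          exact lintegral_enorm_sub_average_sq_le μ hg
      _ = _ := by ring
  calc _ = eLpNorm u p (μ.restrict (ball 0 1)) := by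
        refine eLpNorm_congr_ae ?_
        filter_upwards [ae_restrict_mem measurableSet_ball] with x hx
        simp [hu_def, η.one_of_mem_closedBall (ball_subset_closedBall hx)]
    _ ≤ eLpNorm u p μ := eLpNorm_restrict_le _ _ _ _
    _ ≤ SNormLESNormFDerivOfEqConst ℝ μ 2 * eLpNorm (fderiv ℝ u) 2 μ :=
        eLpNorm_le_eLpNorm_fderiv_of_eq (p := 2) μ hu h2u (by norm_num) hn (by simpa using hp)
    _ ≤ SNormLESNormFDerivOfEqConst ℝ μ 2 * (2 * (1 + k ^ 2 * A) * D) ^ (1 / 2 : ℝ) := by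
        gcongr
        rw [eLpNorm_eq_lintegral_rpow_enorm_toReal (by simp) (by simp)]
        simp only [ENNReal.toReal_ofNat, ENNReal.rpow_two]
        gcongr
    _ = _ := by
        rw [ENNReal.mul_rpow_of_nonneg _ _ (by norm_num), mul_assoc]

theorem exists_eLpNorm_cond_ball_le {p : NNReal} (hn : 0 < Module.finrank ℝ E)
    (hp : (p : ℝ)⁻¹ = 2⁻¹ - (Module.finrank ℝ E : ℝ)⁻¹) :
    ∃ C : ℝ≥0∞, C ≠ ⊤ ∧ ∀ h : E → ℝ, ContDiff ℝ 1 h → ∀ (y : E) (ε : ℝ), 0 < ε →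
      ENNReal.ofReal (1 / ε) *
        eLpNorm (fun x => h x - ∫ z, h z ∂(ProbabilityTheory.cond μ (ball y ε))) p
          (ProbabilityTheory.cond μ (ball y ε)) ≤
      C * (∫⁻ x, ‖fderiv ℝ h x‖ₑ ^ 2 ∂(ProbabilityTheory.cond μ (ball y (ε * 2)))) ^
        (1 / 2 : ℝ) := by
  obtain ⟨C, hC, hg⟩ := exists_eLpNorm_sub_average_le μ hn hp
  set m₁ := (μ (ball (0 : E) 1))⁻¹ ^ (1 / (p : ℝ≥0∞)).toReal with hm₁
  set m₂ := μ (ball (0 : E) 2)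
  have hB1 : (μ (ball (0 : E) 1))⁻¹ ≠ ⊤ :=
    ENNReal.inv_ne_top.mpr (measure_ball_pos μ 0 one_pos).ne'
  have hm₂_top : m₂ ≠ ⊤ := measure_ball_lt_top.ne
  have hm₂_zero : m₂ ≠ 0 := (measure_ball_pos μ 0 two_pos).ne'
  refine ⟨m₁ * C * m₂ ^ (1 / 2 : ℝ), ?_, fun h hh y ε hε => ?_⟩
  · refine ENNReal.mul_ne_top (ENNReal.mul_ne_top ?_ hC) ?_
    · exact ENNReal.rpow_ne_top_of_nonneg (by positivity) hB1
    · exact ENNReal.rpow_ne_top_of_nonneg (by norm_num) hm₂_top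
  have hφ := measurableEmbedding_add_smul y hε.ne'
  set g : E → ℝ := fun x => h (y + ε • x)
  have hgd : ContDiff ℝ 1 g := hh.comp (by fun_prop)
  have hfd : ∀ x, fderiv ℝ g x = ε • fderiv ℝ h (y + ε • x) := fun x => by
    have h1 : HasFDerivAt (fun x : E => y + ε • x) (ε • ContinuousLinearMap.id ℝ E) x :=
      ((hasFDerivAt_id x).const_smul ε).const_add y
    have h2 := ((hh.differentiable one_ne_zero (y + ε • x)).hasFDerivAt.comp x h1).fderiv
    rw [ContinuousLinearMap.comp_smul, ContinuousLinearMap.comp_id] at h2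
    exact h2
  have hmap1 := map_cond_ball μ y hε 1
  rw [mul_one] at hmap1
  have hmean : ∫ z, g z ∂(ProbabilityTheory.cond μ (ball 0 1)) =
      ∫ z, h z ∂(ProbabilityTheory.cond μ (ball y ε)) := by
    rw [← hmap1, hφ.integral_map]
  have hright : ∫⁻ x in ball 0 2, ‖fderiv ℝ g x‖ₑ ^ 2 ∂μ = ENNReal.ofReal ε ^ 2 *
      (m₂ * ∫⁻ x, ‖fderiv ℝ h x‖ₑ ^ 2 ∂(ProbabilityTheory.cond μ (ball y (ε * 2)))) := by
    rw [← map_cond_ball μ y hε 2, hφ.lintegral_map, ProbabilityTheory.cond,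
      lintegral_smul_measure, smul_eq_mul, ← mul_assoc m₂,
      ENNReal.mul_inv_cancel hm₂_zero hm₂_top, one_mul, ← lintegral_const_mul' _ _ (by simp)]
    refine lintegral_congr fun x => ?_
    rw [hfd, enorm_smul, mul_pow, ← ofReal_norm ε, Real.norm_of_nonneg hε.le]
  have hleft : eLpNorm (fun x => h x - ∫ z, h z ∂(ProbabilityTheory.cond μ (ball y ε))) p
        (ProbabilityTheory.cond μ (ball y ε)) =
      m₁ * eLpNorm (fun x => g x - ∫ z, g z ∂(ProbabilityTheory.cond μ (ball 0 1))) p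
        (μ.restrict (ball 0 1)) := by
    rw [hmean, ← smul_eq_mul, hm₁, ← eLpNorm_smul_measure_of_ne_top (by simp)]
    conv_lhs => rw [← hmap1, hφ.eLpNorm_map_measure]
    rw [hmap1]
    rfl
  rw [hleft]
  calc _ ≤ ENNReal.ofReal (1 / ε) *
        (m₁ * (C * (∫⁻ x in ball 0 2, ‖fderiv ℝ g x‖ₑ ^ 2 ∂μ) ^ (1 / 2 : ℝ))) := by
        gcongr
        exact hg g hgd
    _ = (ENNReal.ofReal (1 / ε) * ENNReal.ofReal ε) * (m₁ * C * m₂ ^ (1 / 2 : ℝ) *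
        (∫⁻ x, ‖fderiv ℝ h x‖ₑ ^ 2 ∂(ProbabilityTheory.cond μ (ball y (ε * 2)))) ^
          (1 / 2 : ℝ)) := by
        rw [hright, ENNReal.mul_rpow_of_nonneg _ _ (by norm_num),
          ENNReal.mul_rpow_of_nonneg _ _ (by norm_num), ← ENNReal.rpow_two, ← ENNReal.rpow_mul]
        norm_num
        ring
    _ = _ := by
        rw [← ENNReal.ofReal_mul (by positivity), one_div_mul_cancel hε.ne', ENNReal.ofReal_one,
          one_mul]

end

theorem hasDerivAt_abs_rpow_mul_self {p : ℝ} (hp : 1 ≤ p) (t : ℝ) :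
    HasDerivAt (fun t : ℝ => |t| ^ (p - 1) * t) (p * |t| ^ (p - 1)) t := by
  rcases hp.eq_or_lt with rfl | hp
  · simpa using hasDerivAt_id' t
  rcases eq_or_ne t 0 with rfl | ht
  · rw [hasDerivAt_iff_tendsto_slope_zero]
    have h0 : (p - 1) ≠ 0 := by linarith
    have hc : Continuous (fun t : ℝ => |t| ^ (p - 1)) :=
      continuous_abs.rpow_const fun _ => Or.inr (by linarith)
    have := hc.tendsto 0
    simp only [abs_zero, Real.zero_rpow h0] at this
    simp only [abs_zero, Real.zero_rpow h0, mul_zero, zero_add, sub_zero]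
    refine (this.mono_left nhdsWithin_le_nhds).congr' ?_
    filter_upwards [self_mem_nhdsWithin] with s hs
    have hs' : s ≠ 0 := hs
    rw [smul_eq_mul]
    field_simp
  · have h1 := ((hasDerivAt_abs ht).rpow_const (p := p - 1) (Or.inl (by simpa using ht))).mul
      (hasDerivAt_id t)
    have h2 : |t| ^ (p - 1) = |t| ^ (p - 1 - 1) * |t| := by
      rw [← Real.rpow_add_one (by simpa using ht)]; ring_nf
    have h3 : (SignType.sign t : ℝ) * t = |t| := sign_mul_self t
    refine h1.congr_deriv ?_
    simp only [id_eq, mul_one]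
    linear_combination (p - 1) * |t| ^ (p - 1 - 1) * h3 - (p - 1) * h2

theorem contDiff_abs_rpow_mul_self {p : ℝ} (hp : 1 ≤ p) :
    ContDiff ℝ 1 (fun t : ℝ => |t| ^ (p - 1) * t) := by
  rw [contDiff_one_iff_deriv]
  refine ⟨fun t => (hasDerivAt_abs_rpow_mul_self hp t).differentiableAt, ?_⟩
  rw [funext fun t => (hasDerivAt_abs_rpow_mul_self hp t).deriv]
  exact continuous_const.mul (continuous_abs.rpow_const fun _ => Or.inr (by linarith))

theorem enorm_fderiv_abs_rpow_mul_self_sq {F : Type*} [NormedAddCommGroup F]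
    [InnerProductSpace ℝ F] [CompleteSpace F] {p : ℝ} (hp : 1 ≤ p) {H : F → ℝ}
    (hH : Differentiable ℝ H) (x : F) :
    ‖fderiv ℝ (fun x => |H x| ^ (p - 1) * H x) x‖ₑ ^ 2 =
      ENNReal.ofReal p ^ 2 * ENNReal.ofReal |(|H x| ^ (2 * (p - 1)) * ‖gradient H x‖ ^ 2)| := by
  have h1 : fderiv ℝ (fun x => |H x| ^ (p - 1) * H x) x =
      (p * |H x| ^ (p - 1)) • fderiv ℝ H x :=
    ((hasDerivAt_abs_rpow_mul_self hp (H x)).comp_hasFDerivAt x (hH x).hasFDerivAt).fderiv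
  have h2 : ‖gradient H x‖ = ‖fderiv ℝ H x‖ := by
    simp [gradient]
  have hp0 : 0 ≤ p := by linarith
  rw [h1, h2, ← ofReal_norm, ← ENNReal.ofReal_pow (norm_nonneg _), ← ENNReal.ofReal_pow hp0,
    ← ENNReal.ofReal_mul (by positivity), norm_smul, Real.norm_of_nonneg (by positivity),
    abs_of_nonneg (a := |H x| ^ (2 * (p - 1)) * ‖fderiv ℝ H x‖ ^ 2) (by positivity), mul_comm 2, Real.rpow_mul (abs_nonneg _), Real.rpow_two]
  congr 1
  ring

theorem setLIntegral_div_eq_lintegral_cond {α : Type*} [MeasurableSpace α] (μ : Measure α)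
    (s : Set α) (f : α → ℝ≥0∞) :
    (∫⁻ x in s, f x ∂μ) / μ s = ∫⁻ x, f x ∂(ProbabilityTheory.cond μ s) := by
  rw [ProbabilityTheory.cond, lintegral_smul_measure, smul_eq_mul, ENNReal.div_eq_inv_mul]

theorem setAverage_eq_integral_cond {α : Type*} [MeasurableSpace α] (μ : Measure α)
    (s : Set α) (f : α → ℝ) :
    ⨍ x in s, f x ∂μ = ∫ x, f x ∂(ProbabilityTheory.cond μ s) := by
  rw [average, ProbabilityTheory.cond, Measure.restrict_apply_univ]

theorem stmt_5 (N : ℕ) (hN : 2 < N) (p : ℝ) (hp : 1 ≤ p) :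
    ∃ C : ℝ≥0∞, C ≠ ⊤ ∧
      ∀ (H : Euc N → ℝ), ContDiff ℝ 1 H →
      ∀ (y : Euc N) (ε : ℝ), 0 < ε →
        ENNReal.ofReal (1/ε) *
          ((∫⁻ x in ball y ε, ENNReal.ofReal
              (|(|H x| ^ (p-1) * H x) -
                 ⨍ z in ball y ε, (|H z| ^ (p-1) * H z) ∂volume| ^ (2*N/(N-2) : ℝ))
              ∂volume) / volume (ball y ε)) ^ (1 / (2*N/(N-2) : ℝ)) ≤
        C * (maxFn (fun x => |H x| ^ (2*(p-1)) * ‖gradient H x‖^2) y) ^ ((1:ℝ)/2) := by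
  have hN' : (2 : ℝ) < N := by exact_mod_cast hN
  have hs : (0 : ℝ) < 2 * N / (N - 2) := div_pos (by linarith) (by linarith)
  set s : ℝ := 2 * N / (N - 2) with hs_def
  have hfin : Module.finrank ℝ (Euc N) = N := by simp
  obtain ⟨C, hC, hmain⟩ := exists_eLpNorm_cond_ball_le (E := Euc N) volume (p := s.toNNReal)
    (by omega) (by
      rw [hfin, Real.coe_toNNReal s hs.le, hs_def]
      have : (N : ℝ) - 2 ≠ 0 := by linarith
      field_simp)
  refine ⟨C * ENNReal.ofReal p, ENNReal.mul_ne_top hC ENNReal.ofReal_ne_top,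
    fun H hH y ε hε => ?_⟩
  have h1 := hmain _ ((contDiff_abs_rpow_mul_self hp).comp hH) y ε hε
  have hs_coe : (s.toNNReal : ℝ≥0∞).toReal = s := by simp [hs.le]
  rw [eLpNorm_eq_lintegral_rpow_enorm_toReal
    (by simpa using hs) (by simp), hs_coe] at h1
  rw [setLIntegral_div_eq_lintegral_cond, setAverage_eq_integral_cond]
  calc _ ≤ _ := by
        refine le_of_eq_of_le ?_ h1
        congr 3
        ext x
        rw [← ENNReal.ofReal_rpow_of_nonneg (abs_nonneg _) hs.le, ← Real.enorm_eq_ofReal_abs]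
        rfl
    _ ≤ C * (ENNReal.ofReal p ^ 2 *
          maxFn (fun x => |H x| ^ (2*(p-1)) * ‖gradient H x‖^2) y) ^ ((1:ℝ)/2) := by
        gcongr
        refine (lintegral_congr fun x =>
          enorm_fderiv_abs_rpow_mul_self_sq hp (hH.differentiable one_ne_zero) x).trans_le ?_
        rw [lintegral_const_mul' _ _ (by simp), ← setLIntegral_div_eq_lintegral_cond]
        gcongr
        exact le_iSup₂_of_le (ε * 2) (by positivity) le_rfl
    _ = _ := by
        rw [ENNReal.mul_rpow_of_nonneg _ _ (by norm_num), ← ENNReal.rpow_two, ← ENNReal.rpow_mul]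
        norm_num
        ring
end
end
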